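/- Every bispecial word u ∈ L(Ω) is a prefix of the fixed point ω, and u can be extended on the left by every letter: for every a ∈ A, the word au belongs to L(Ω). -/

import Mathlib

/-- The substitution σ on the alphabet A = {1, …, d}:
σ(1) = 12, σ(k) = k+1 for 2 ≤ k ≤ d−1, σ(d) = 1. Letters are literal natural numbers. -/
def sig (d : ℕ) (a : ℕ) : List ℕ :=
  if a = 1 then [1, 2] else if a = d then [1] else [a + 1]

/-- Extension of a substitution to finite words by concatenation. -/
def applySub (f : ℕ → List ℕ) : List ℕ → List ℕ
  | [] => []
  | a :: w => f a ++ applySub f w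

/-- σⁿ applied to a word. -/
def sigIter (d n : ℕ) (w : List ℕ) : List ℕ := (applySub (sig d))^[n] w

/-- The language L(Ω): the set of finite factors of the fixed point ω, i.e. of the
words σⁿ(1). -/
def Lang (d : ℕ) (u : List ℕ) : Prop := ∃ n : ℕ, u <:+: sigIter d n [1]

/-- `w` is a (finite) prefix of the infinite word `V`. -/
def PrefixOfInf (w : List ℕ) (V : ℕ → ℕ) : Prop :=
  ∀ (i : ℕ) (h : i < w.length), w.get ⟨i, h⟩ = V i

/-- `ω` is the fixed point of σ: the unique infinite word admitting every σⁿ(1) as a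
prefix. -/
def IsSigmaFixedPoint (d : ℕ) (ω : ℕ → ℕ) : Prop :=
  ∀ n : ℕ, PrefixOfInf (sigIter d n [1]) ω

/-- `u` is left-special: there are distinct letters a, b ∈ A with au, bu ∈ L(Ω). -/
def LeftSpecial (d : ℕ) (u : List ℕ) : Prop :=
  ∃ a b : ℕ, a ≠ b ∧ 1 ≤ a ∧ a ≤ d ∧ 1 ≤ b ∧ b ≤ d ∧
    Lang d (a :: u) ∧ Lang d (b :: u)

/-- `u` is right-special: there are distinct letters a, b ∈ A with ua, ub ∈ L(Ω). -/
def RightSpecial (d : ℕ) (u : List ℕ) : Prop :=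
  ∃ a b : ℕ, a ≠ b ∧ 1 ≤ a ∧ a ≤ d ∧ 1 ≤ b ∧ b ≤ d ∧
    Lang d (u ++ [a]) ∧ Lang d (u ++ [b])

/-- `u` is bispecial: both left- and right-special. -/
def Bispecial (d : ℕ) (u : List ℕ) : Prop := LeftSpecial d u ∧ RightSpecial d u

/-- The shift S on infinite words. -/
def shiftMap (V : ℕ → ℕ) : ℕ → ℕ := fun i => V (i + 1)

/-- Ω⁺ : the closure (for the product topology, letters discrete) of the shift
orbit of ω. -/
def OmegaPlus (ω : ℕ → ℕ) : Set (ℕ → ℕ) :=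
  closure {V : ℕ → ℕ | ∃ n : ℕ, V = shiftMap^[n] ω}

/-- The cylinder C_u = {V ∈ Ω⁺ : u is a prefix of V}. -/
def Cyl (ω : ℕ → ℕ) (u : List ℕ) : Set (ℕ → ℕ) :=
  {V | V ∈ OmegaPlus ω ∧ PrefixOfInf u V}

/-- Prepending a letter to an infinite word. -/
def consInf (a : ℕ) (V : ℕ → ℕ) : ℕ → ℕ :=
  fun i => match i with
  | 0 => a
  | j + 1 => V j

/-- Extension of σ to infinite words: σ(V) = σ(V₀)σ(V₁)σ(V₂)⋯ (each σ(a) is a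
nonempty word, so the n-th letter of σ(V) is the n-th letter of σ(V₀…Vₙ)). -/
def sigInf (d : ℕ) (V : ℕ → ℕ) : ℕ → ℕ :=
  fun n => (applySub (sig d) ((List.range (n + 1)).map V)).getD n 0

/-- Concatenation of a finite list of words. -/
def concatAll : List (List ℕ) → List ℕ
  | [] => []
  | w :: ws => w ++ concatAll ws

/-- Every letter of `w` belongs to the alphabet {1, …, d}. -/
def IsWord (d : ℕ) (w : List ℕ) : Prop := ∀ x ∈ w, 1 ≤ x ∧ x ≤ d

/-- The last letter of σ(a): the cyclic successor of `a`. -/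
def cyclicSucc (d a : ℕ) : ℕ := if a = d then 1 else a + 1

/-- In the language, every letter other than 1 is preceded by its predecessor. -/
def Follows (a b : ℕ) : Prop := b = 1 ∨ b = a + 1

/-- `w` is a prefix of some σⁿ(1). -/
def IsFixedPrefix (d : ℕ) (w : List ℕ) : Prop := ∃ n : ℕ, w <+: sigIter d n [1]

section Substitution

variable {d : ℕ}

lemma applySub_append (f : ℕ → List ℕ) (v w : List ℕ) :
    applySub f (v ++ w) = applySub f v ++ applySub f w := by
  induction v with
  | nil => rfl
  | cons a v ih => simp [applySub, ih]

lemma sigIter_succ (n : ℕ) (w : List ℕ) :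
    sigIter d (n + 1) w = applySub (sig d) (sigIter d n w) :=
  Function.iterate_succ_apply' _ _ _

lemma sigIter_succ' (n : ℕ) (w : List ℕ) :
    sigIter d (n + 1) w = sigIter d n (applySub (sig d) w) :=
  Function.iterate_succ_apply _ _ _

lemma sigIter_append (n : ℕ) (v w : List ℕ) :
    sigIter d n (v ++ w) = sigIter d n v ++ sigIter d n w := by
  induction n with
  | zero => rfl
  | succ n ih => simp only [sigIter_succ, ih, applySub_append]

lemma sig_one : sig d 1 = [1, 2] := by simp [sig]

lemma sig_of_ne_one {a : ℕ} (ha : a ≠ 1) : sig d a = [cyclicSucc d a] := by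
  simp only [sig, cyclicSucc, if_neg ha]
  split_ifs <;> rfl

lemma sig_last (hd : 3 ≤ d) (a : ℕ) : ∃ p, sig d a = p ++ [cyclicSucc d a] := by
  by_cases ha : a = 1
  · subst ha
    exact ⟨[1], by simp [sig_one, cyclicSucc, show 1 ≠ d by omega]⟩
  · exact ⟨[], sig_of_ne_one ha⟩

lemma sig_top (hd : 3 ≤ d) : sig d d = [1] := by
  simp [sig, show d ≠ 1 by omega]

lemma cyclicSucc_injective {a b : ℕ} (ha : 1 ≤ a) (hb : 1 ≤ b)
    (h : cyclicSucc d a = cyclicSucc d b) : a = b := by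
  unfold cyclicSucc at h
  split_ifs at h <;> omega

lemma length_le_length_applySub (w : List ℕ) :
    w.length ≤ (applySub (sig d) w).length := by
  induction w with
  | nil => simp
  | cons a w ih =>
    have : 1 ≤ (sig d a).length := by unfold sig; split_ifs <;> simp
    simp only [applySub, List.length_append, List.length_cons]
    omega

lemma sigIter_ne_nil (n : ℕ) {w : List ℕ} (hw : w ≠ []) : sigIter d n w ≠ [] := by
  induction n with
  | zero => exact hw
  | succ n ih =>
    rw [sigIter_succ]
    intro h
    have := length_le_length_applySub (d := d) (sigIter d n w)
    rw [h] at this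
    exact ih (List.eq_nil_of_length_eq_zero (by simpa using this))

lemma IsWord.applySub (hd : 3 ≤ d) {w : List ℕ} (hw : IsWord d w) :
    IsWord d (applySub (sig d) w) := by
  induction w with
  | nil => exact hw
  | cons a w ih =>
    have ha := hw a (by simp)
    have ih := ih fun x hx => hw x (by simp [hx])
    intro x hx
    rcases List.mem_append.1 hx with hx | hx
    · unfold sig at hx
      split_ifs at hx <;> simp at hx <;> omega
    · exact ih x hx

lemma applySub_injective (hd : 3 ≤ d) {v w : List ℕ} (hv : IsWord d v) (hw : IsWord d w)
    (h : applySub (sig d) v = applySub (sig d) w) : v = w := by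
  induction v using List.reverseRecOn generalizing w with
  | nil =>
    have := length_le_length_applySub (d := d) w
    rw [← h] at this
    exact (List.eq_nil_of_length_eq_zero (by simpa [applySub] using this)).symm
  | append_singleton v a ih =>
    rcases List.eq_nil_or_concat w with rfl | ⟨w, b, rfl⟩
    · have := length_le_length_applySub (d := d) (v ++ [a])
      rw [h] at this
      simp [_root_.applySub] at this
    · obtain ⟨p, hp⟩ := sig_last hd a
      obtain ⟨q, hq⟩ := sig_last hd b
      have h2 := h
      simp only [List.concat_eq_append, applySub_append, applySub, List.append_nil, hp, hq,
        ← List.append_assoc] at h2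
      have hab : a = b := cyclicSucc_injective (hv a (by simp)).1 (hw b (by simp)).1
        (List.append_inj_right' h2 rfl |> List.singleton_inj.1)
      subst hab
      simp only [List.concat_eq_append, applySub_append] at h
      rw [ih (fun x hx => hv x (by simp [hx])) (fun x hx => hw x (by simp [hx]))
        (List.append_cancel_right h)]
      simp

lemma isChain_follows_applySub (hd : 3 ≤ d) {w : List ℕ} (hw : IsWord d w)
    (h : w.IsChain Follows) : (applySub (sig d) w).IsChain Follows := by
  induction w with
  | nil => exact h
  | cons a w ih =>
    have ih := ih (fun x hx => hw x (by simp [hx])) h.tail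
    have ha := hw a (by simp)
    obtain ⟨p, hp⟩ := sig_last hd a
    refine List.isChain_append.2 ⟨?_, ih, ?_⟩
    · by_cases h1 : a = 1
      · subst h1
        simp [sig_one, Follows]
      · simp [sig_of_ne_one h1]
    · intro x hx y hy
      have hx : x = cyclicSucc d a := by simpa [hp, eq_comm] using hx
      cases w with
      | nil => simp [applySub] at hy
      | cons b w =>
        have hb := hw b (by simp)
        have hab : Follows a b := (List.isChain_cons_cons.1 h).1
        have hy' : y = 1 ∨ (y = b + 1 ∧ b ≠ 1 ∧ b ≠ d) := by
          simp only [applySub, sig] at hy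
          split_ifs at hy with h1 h2 <;> simp at hy <;> omega
        subst hx
        rcases hy' with rfl | ⟨rfl, h1, h2⟩
        · exact Or.inl rfl
        · rcases hab with rfl | rfl
          · exact absurd rfl h1
          · right
            simp [cyclicSucc, show a ≠ d by omega]

lemma sigIter_isWord_isChain (hd : 3 ≤ d) (n : ℕ) :
    IsWord d (sigIter d n [1]) ∧ (sigIter d n [1]).IsChain Follows := by
  induction n with
  | zero => exact ⟨by simp [IsWord, sigIter]; omega, by simp [sigIter]⟩
  | succ n ih =>
    rw [sigIter_succ]
    exact ⟨ih.1.applySub hd, isChain_follows_applySub hd ih.1 ih.2⟩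

lemma Lang.isWord (hd : 3 ≤ d) {w : List ℕ} (h : Lang d w) : IsWord d w := by
  obtain ⟨n, hn⟩ := h
  exact fun x hx => (sigIter_isWord_isChain hd n).1 x (hn.subset hx)

lemma Lang.isChain (hd : 3 ≤ d) {w : List ℕ} (h : Lang d w) : w.IsChain Follows := by
  obtain ⟨n, s, t, hn⟩ := h
  have h := (sigIter_isWord_isChain hd n).2
  rw [← hn] at h
  exact h.left_of_append.right_of_append

lemma Lang.of_factor {v w : List ℕ} (h : Lang d w) (hv : v <:+: w) : Lang d v := by
  obtain ⟨n, hn⟩ := h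
  exact ⟨n, hv.trans hn⟩

lemma Lang.applySub {w : List ℕ} (h : Lang d w) : Lang d (applySub (sig d) w) := by
  obtain ⟨n, s, t, h⟩ := h
  exact ⟨n + 1, _root_.applySub (sig d) s, _root_.applySub (sig d) t, by
    rw [sigIter_succ, ← h, applySub_append, applySub_append]⟩

lemma IsFixedPrefix.of_isPrefix {v w : List ℕ} (h : IsFixedPrefix d w) (hv : v <+: w) :
    IsFixedPrefix d v := by
  obtain ⟨n, hn⟩ := h
  exact ⟨n, hv.trans hn⟩

lemma IsFixedPrefix.lang {w : List ℕ} (h : IsFixedPrefix d w) : Lang d w := by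
  obtain ⟨n, hn⟩ := h
  exact ⟨n, hn.isInfix⟩

lemma IsFixedPrefix.applySub {w : List ℕ} (h : IsFixedPrefix d w) :
    IsFixedPrefix d (applySub (sig d) w) := by
  obtain ⟨n, t, h⟩ := h
  exact ⟨n + 1, _root_.applySub (sig d) t, by rw [sigIter_succ, ← h, applySub_append]⟩

lemma IsFixedPrefix.exists_append {w : List ℕ} (h : IsFixedPrefix d w) :
    ∃ x, IsFixedPrefix d (w ++ [x]) := by
  obtain ⟨n, t, h⟩ := h
  have h2 : sigIter d (n + 1) [1] = w ++ (t ++ sigIter d n [2]) := by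
    rw [sigIter_succ', ← List.append_assoc, h, ← sigIter_append]
    simp [_root_.applySub, sig_one]
  obtain ⟨x, s, hs⟩ := List.exists_cons_of_ne_nil
    (List.append_ne_nil_of_right_ne_nil t (sigIter_ne_nil (d := d) n (List.cons_ne_nil 2 [])))
  exact ⟨x, n + 1, s, by rw [h2, hs]; simp⟩

lemma IsFixedPrefix.prefixOfInf {w : List ℕ} {ω : ℕ → ℕ} (hω : IsSigmaFixedPoint d ω)
    (h : IsFixedPrefix d w) : PrefixOfInf w ω := by
  obtain ⟨n, hn⟩ := h
  intro i hi
  rw [← hω n i (hi.trans_le hn.length_le)]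
  simpa using hn.getElem hi

end Substitution

section LeftExtension

variable {d : ℕ}

lemma lang_cyclicSucc_cons (hd : 3 ≤ d) {a : ℕ} {w : List ℕ} (h : Lang d (a :: w)) :
    Lang d (cyclicSucc d a :: applySub (sig d) w) := by
  obtain ⟨p, hp⟩ := sig_last hd a
  exact h.applySub.of_factor (List.IsSuffix.isInfix ⟨p, by simp [applySub, hp]⟩)

/-- A property stable under the cyclic successor that holds for one letter holds for all. -/
lemma forall_of_cyclicSucc {P : ℕ → Prop} (h0 : P d)
    (hs : ∀ a, 1 ≤ a → a ≤ d → P a → P (cyclicSucc d a)) (hd : 1 ≤ d) :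
    ∀ a, 1 ≤ a → a ≤ d → P a := by
  intro a ha
  induction a, ha using Nat.le_induction with
  | base => exact fun _ => by simpa [cyclicSucc] using hs d hd le_rfl h0
  | succ a ha ih =>
    intro had
    simpa [cyclicSucc, show a ≠ d by omega] using hs a ha (by omega) (ih (by omega))

lemma lang_pair (hd : 3 ≤ d) {k : ℕ} (hk : 1 ≤ k) : k + 1 ≤ d → Lang d [k, k + 1] := by
  induction k, hk using Nat.le_induction with
  | base => exact fun _ => ⟨1, by simp [sigIter, applySub, sig_one]⟩
  | succ k hk ih =>
    intro hkd
    simpa [applySub, cyclicSucc, sig, show k ≠ d by omega, show k + 1 ≠ d by omega,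
      show k ≠ 0 by omega] using lang_cyclicSucc_cons hd (ih (by omega))

lemma lang_top_one (hd : 3 ≤ d) : Lang d [d, 1] := by
  obtain ⟨k, rfl⟩ : ∃ k, d = k + 1 := ⟨d - 1, by omega⟩
  simpa [applySub, cyclicSucc, sig_top hd] using
    lang_cyclicSucc_cons hd (lang_pair hd (k := k) (by omega) le_rfl)

lemma lang_cons_one (hd : 3 ≤ d) : ∀ a, 1 ≤ a → a ≤ d → Lang d [a, 1] := by
  refine forall_of_cyclicSucc (lang_top_one hd) (fun a _ _ h => ?_) (by omega)
  exact (lang_cyclicSucc_cons hd h).of_factor ⟨[], [2], by simp [applySub, sig_one]⟩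

lemma lang_cons_sigIter (hd : 3 ≤ d) (n : ℕ) :
    ∀ a, 1 ≤ a → a ≤ d → Lang d (a :: sigIter d n [1]) := by
  induction n with
  | zero => exact lang_cons_one hd
  | succ n ih =>
    have hs : ∀ a, 1 ≤ a → a ≤ d → Lang d (cyclicSucc d a :: sigIter d (n + 1) [1]) := by
      intro a h1 h2
      rw [sigIter_succ]
      exact lang_cyclicSucc_cons hd (ih a h1 h2)
    refine forall_of_cyclicSucc ?_ (fun a h1 h2 _ => hs a h1 h2) (by omega)
    simpa [cyclicSucc, show d - 1 ≠ d by omega, show d - 1 + 1 = d by omega] using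
      hs (d - 1) (by omega) (by omega)

lemma IsFixedPrefix.lang_cons (hd : 3 ≤ d) {w : List ℕ} (h : IsFixedPrefix d w) {a : ℕ}
    (h1 : 1 ≤ a) (h2 : a ≤ d) : Lang d (a :: w) := by
  obtain ⟨n, t, hn⟩ := h
  exact (lang_cons_sigIter hd n a h1 h2).of_factor ⟨[], t, by simp [← hn]⟩

end LeftExtension

section Desubstitution

variable {d : ℕ}

lemma exists_of_prefix_applySub {z u : List ℕ} (h : u <+: applySub (sig d) z) :
    ∃ w, (w <+: z ∧ u = applySub (sig d) w) ∨
      (w ++ [1] <+: z ∧ u = applySub (sig d) w ++ [1]) := by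
  induction z generalizing u with
  | nil => exact ⟨[], Or.inl ⟨List.prefix_rfl, by simpa [applySub] using h⟩⟩
  | cons a z ih =>
    have step : ∀ v, v <+: applySub (sig d) z →
        ∃ w, (w <+: a :: z ∧ sig d a ++ v = applySub (sig d) w) ∨
          (w ++ [1] <+: a :: z ∧ sig d a ++ v = applySub (sig d) w ++ [1]) := by
      intro v hv
      obtain ⟨w, ⟨hw, rfl⟩ | ⟨hw, rfl⟩⟩ := ih hv
      · exact ⟨a :: w, Or.inl ⟨by simpa using hw, rfl⟩⟩
      · exact ⟨a :: w, Or.inr ⟨by simpa using hw, by simp [applySub]⟩⟩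
    cases u with
    | nil => exact ⟨[], Or.inl ⟨⟨_, rfl⟩, rfl⟩⟩
    | cons x u =>
      by_cases ha : a = 1
      · subst ha
        simp only [applySub, sig_one, List.cons_append, List.nil_append,
          List.cons_prefix_cons] at h
        obtain ⟨rfl, h⟩ := h
        cases u with
        | nil => exact ⟨[], Or.inr ⟨by simp, by simp [applySub]⟩⟩
        | cons y u =>
          obtain ⟨rfl, hu⟩ := List.cons_prefix_cons.1 h
          simpa [sig_one] using step u hu
      · simp only [applySub, sig_of_ne_one ha, List.cons_append, List.nil_append,
          List.cons_prefix_cons] at h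
        obtain ⟨rfl, h⟩ := h
        simpa [sig_of_ne_one ha] using step u h

lemma exists_of_applySub_eq {z s v : List ℕ} {a : ℕ} (hd : 3 ≤ d)
    (h : applySub (sig d) z = s ++ a :: 1 :: v) :
    ∃ z₁ b z₂, z = z₁ ++ b :: z₂ ∧ cyclicSucc d b = a ∧ applySub (sig d) z₂ = 1 :: v := by
  induction z generalizing s with
  | nil => simp [applySub] at h
  | cons x z ih =>
    have step : ∀ s', applySub (sig d) z = s' ++ a :: 1 :: v →
        ∃ z₁ b z₂, x :: z = z₁ ++ b :: z₂ ∧ cyclicSucc d b = a ∧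
          applySub (sig d) z₂ = 1 :: v := by
      intro s' hs
      obtain ⟨z₁, b, z₂, rfl, hb, hz⟩ := ih hs
      exact ⟨x :: z₁, b, z₂, rfl, hb, hz⟩
    by_cases hx : x = 1
    · subst hx
      simp only [applySub, sig_one, List.cons_append, List.nil_append] at h
      rcases s with _ | ⟨y, _ | ⟨y', s⟩⟩
      · simp at h
      · simp only [List.cons_append, List.nil_append, List.cons.injEq] at h
        exact ⟨[], 1, z, rfl, by simp [cyclicSucc, show 1 ≠ d by omega, ← h.2.1], h.2.2⟩
      · simp only [List.cons_append, List.cons.injEq] at h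
        exact step s h.2.2
    · simp only [applySub, sig_of_ne_one hx, List.cons_append, List.nil_append] at h
      rcases s with _ | ⟨y, s⟩
      · simp only [List.nil_append, List.cons.injEq] at h
        exact ⟨[], x, z, rfl, h.1, h.2⟩
      · simp only [List.cons_append, List.cons.injEq] at h
        exact step s h.2

lemma Lang.exists_preimage (hd : 3 ≤ d) {a : ℕ} {v : List ℕ} (h : Lang d (a :: 1 :: v)) :
    ∃ b w, cyclicSucc d b = a ∧
      ((Lang d (b :: w) ∧ 1 :: v = _root_.applySub (sig d) w) ∨
        (Lang d (b :: (w ++ [1])) ∧ 1 :: v = _root_.applySub (sig d) w ++ [1])) := by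
  obtain ⟨n, s, t, h⟩ := h
  cases n with
  | zero =>
    have := congrArg List.length h
    simp [sigIter] at this
    omega
  | succ n =>
    rw [sigIter_succ] at h
    obtain ⟨z₁, b, z₂, hz, hb, hz₂⟩ := exists_of_applySub_eq (s := s) (v := v ++ t) (a := a) hd
      (by rw [← h]; simp)
    obtain ⟨w, hw⟩ := exists_of_prefix_applySub (d := d) (z := z₂) (u := 1 :: v)
      ⟨t, by rw [hz₂]; rfl⟩
    have key : ∀ w', w' <+: z₂ → Lang d (b :: w') := by
      rintro w' ⟨r, rfl⟩
      exact ⟨n, z₁, r, by rw [hz]; simp⟩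
    exact ⟨b, w, hb, hw.imp (fun h => ⟨key _ h.1, h.2⟩) (fun h => ⟨key _ h.1, h.2⟩)⟩

end Desubstitution

section LeftSpecial

variable {d : ℕ}

lemma leftSpecial_of_lang (hd : 3 ≤ d) {a b : ℕ} {u : List ℕ} (hab : a ≠ b)
    (ha : Lang d (a :: u)) (hb : Lang d (b :: u)) : LeftSpecial d u := by
  have h1 := ha.isWord hd a (by simp)
  have h2 := hb.isWord hd b (by simp)
  exact ⟨a, b, hab, h1.1, h1.2, h2.1, h2.2, ha, hb⟩

lemma LeftSpecial.of_isPrefix {u v : List ℕ} (h : LeftSpecial d u) (hv : v <+: u) :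
    LeftSpecial d v := by
  obtain ⟨a, b, hab, ha1, ha2, hb1, hb2, ha, hb⟩ := h
  obtain ⟨t, rfl⟩ := hv
  exact ⟨a, b, hab, ha1, ha2, hb1, hb2, ha.of_factor ⟨[], t, by simp⟩,
    hb.of_factor ⟨[], t, by simp⟩⟩

lemma LeftSpecial.head_eq_one (hd : 3 ≤ d) {x : ℕ} {u : List ℕ}
    (h : LeftSpecial d (x :: u)) : x = 1 := by
  obtain ⟨a, b, hab, -, -, -, -, ha, hb⟩ := h
  have h1 : Follows a x := (List.isChain_cons_cons.1 (ha.isChain hd)).1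
  have h2 : Follows b x := (List.isChain_cons_cons.1 (hb.isChain hd)).1
  unfold Follows at h1 h2
  omega

lemma LeftSpecial.length_lt (hd : 3 ≤ d) {w : List ℕ} (h : LeftSpecial d w) (hw : w ≠ []) :
    w.length < (applySub (sig d) w).length := by
  obtain ⟨x, w, rfl⟩ := List.exists_cons_of_ne_nil hw
  obtain rfl := h.head_eq_one hd
  have := length_le_length_applySub (d := d) w
  simp only [applySub, sig_one, List.length_append, List.length_cons, List.length_nil]
  omega

/-- If σ(w)1 arises once from w1 and once from wd, and `w` is a nonempty prefix of ω, then
σ(w)1 is a prefix of ω. -/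
lemma IsFixedPrefix.applySub_append_one (hd : 3 ≤ d) {w : List ℕ} (hw : w ≠ [])
    (h : IsFixedPrefix d w) (hwd : Lang d (w ++ [d])) :
    IsFixedPrefix d (_root_.applySub (sig d) w ++ [1]) := by
  obtain ⟨x, hx⟩ := h.exists_append
  obtain ⟨w, k, rfl⟩ := (List.eq_nil_or_concat w).resolve_left hw
  have follows : ∀ y, Lang d (w.concat k ++ [y]) → Follows k y := by
    intro y hy
    have h2 := (hy.of_factor (v := [k, y]) ⟨w, [], by simp⟩).isChain hd
    exact (List.isChain_cons_cons.1 h2).1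
  have h1 := follows d hwd
  have h2 := follows x hx.lang
  have hxd : x = 1 ∨ x = d := by
    unfold Follows at h1 h2
    omega
  refine hx.applySub.of_isPrefix ?_
  rw [applySub_append]
  rcases hxd with rfl | rfl
  · exact ⟨[2], by simp [_root_.applySub, sig_one]⟩
  · exact ⟨[], by simp [_root_.applySub, sig_top hd]⟩

theorem LeftSpecial.isFixedPrefix (hd : 3 ≤ d) {u : List ℕ} (hu : LeftSpecial d u) :
    IsFixedPrefix d u := by
  induction hn : u.length using Nat.strong_induction_on generalizing u with
  | _ n ih =>
  subst hn
  rcases u with _ | ⟨x, v⟩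
  · exact ⟨0, ⟨_, rfl⟩⟩
  obtain rfl := hu.head_eq_one hd
  obtain ⟨a, b, hab, -, -, -, -, ha, hb⟩ := hu
  obtain ⟨a', w, rfl, hw⟩ := ha.exists_preimage hd
  obtain ⟨b', w', rfl, hw'⟩ := hb.exists_preimage hd
  have hab' : a' ≠ b' := fun h => hab (by rw [h])
  have word : ∀ {c : ℕ} {t t' : List ℕ}, Lang d (c :: (t ++ t')) → IsWord d t :=
    fun h x hx => h.isWord hd x (by simp [hx])
  have isFixedPrefix_one : IsFixedPrefix d [1] := ⟨0, List.prefix_rfl⟩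
  have mixed : ∀ {p q : ℕ} {t t' : List ℕ}, p ≠ q → Lang d (p :: t) →
      1 :: v = applySub (sig d) t → Lang d (q :: (t' ++ [1])) →
      1 :: v = applySub (sig d) t' ++ [1] → IsFixedPrefix d (1 :: v) := by
    intro p q t t' hpq hp ht hq ht'
    have hdd : IsWord d (t' ++ [d]) := by
      intro x hx
      rcases List.mem_append.1 hx with hx | hx
      · exact word hq x hx
      · simp at hx
        omega
    obtain rfl : t = t' ++ [d] := by
      refine applySub_injective hd (word (t' := []) (by simpa using hp)) hdd ?_
      rw [← ht, ht', applySub_append]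
      simp [applySub, sig_top hd]
    rw [ht']
    by_cases hnil : t' = []
    · simpa [hnil, applySub] using isFixedPrefix_one
    have hls : LeftSpecial d t' := leftSpecial_of_lang hd hpq
      (hp.of_factor ⟨[], [d], by simp⟩) (hq.of_factor ⟨[], [1], by simp⟩)
    have hlen := hls.length_lt hd hnil
    refine (ih _ ?_ hls rfl).applySub_append_one hd hnil
      (hp.of_factor (List.suffix_cons _ _).isInfix)
    rw [ht', List.length_append]
    omega
  rcases hw with ⟨hl, he⟩ | ⟨hl, he⟩ <;> rcases hw' with ⟨hl', he'⟩ | ⟨hl', he'⟩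
  · obtain rfl : w = w' := applySub_injective hd (word (t' := []) (by simpa using hl))
      (word (t' := []) (by simpa using hl')) (he.symm.trans he')
    have hls : LeftSpecial d w := leftSpecial_of_lang hd hab' hl hl'
    have hnil : w ≠ [] := by
      rintro rfl
      simp [applySub] at he
    rw [he]
    refine (ih _ ?_ hls rfl).applySub
    rw [he]
    exact hls.length_lt hd hnil
  · exact mixed hab' hl he hl' he'
  · exact mixed hab'.symm hl' he' hl he
  · obtain rfl : w = w' := applySub_injective hd (word hl) (word hl')
      (List.append_cancel_right (he.symm.trans he'))
    have hls : LeftSpecial d (w ++ [1]) := leftSpecial_of_lang hd hab' hl hl'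
    rw [he]
    by_cases hnil : w = []
    · simpa [hnil, applySub] using isFixedPrefix_one
    have hlen := (hls.of_isPrefix ⟨[1], rfl⟩).length_lt hd hnil
    have hp : IsFixedPrefix d (w ++ [1]) := by
      refine ih _ ?_ hls rfl
      rw [he, List.length_append, List.length_append]
      omega
    refine hp.applySub.of_isPrefix ⟨[2], ?_⟩
    simp [applySub_append, applySub, sig_one]

end LeftSpecial

/-- Every bispecial word u ∈ L(Ω) is a prefix of ω and can be extended on the left
by every letter a ∈ A. -/
theorem stmt_9 (d : ℕ) (hd : 3 ≤ d) (ω : ℕ → ℕ) (hω : IsSigmaFixedPoint d ω)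
    (u : List ℕ) (hu : Lang d u) (hbi : Bispecial d u) :
    PrefixOfInf u ω ∧ ∀ a : ℕ, 1 ≤ a → a ≤ d → Lang d (a :: u) := by
  have h := hbi.1.isFixedPrefix hd
  exact ⟨h.prefixOfInf hω, fun a h1 h2 => h.lang_cons hd h1 h2⟩
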